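/- Let α be badly approximable with constant δ (0 < δ < 1). If ε > 0 is small enough, then for q₀ large enough the following holds: for any integers q₁ ≥ q₀, q₂ = q₁³, q₃ = q₂³, if mes(B_{q₂}) ≥ mes(B_{q₁})/2 > 0, then mes(B_{q₃}) ≥ mes(B_{q₂})/2 > 0. -/

import Mathlib

open MeasureTheory

/-- Distance from a real number to the nearest integer. -/
noncomputable def nint (t : ℝ) : ℝ := |t - round t|

/-- The "dangerous" neighbourhood `E(x)` of rationals with denominator `x`:
`E(x) = (⋃_{y=0}^{x} [y/x − ε/(‖αx‖x²log₂²x), y/x + ε/(‖αx‖x²log₂²x)]) ∩ [0,1]`. -/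
noncomputable def Eset (α ε : ℝ) (x : ℕ) : Set ℝ :=
  (⋃ y ∈ Finset.range (x + 1),
      Set.Icc ((y : ℝ) / x - ε / (nint (α * x) * (x : ℝ) ^ 2 * (Real.logb 2 x) ^ 2))
              ((y : ℝ) / x + ε / (nint (α * x) * (x : ℝ) ^ 2 * (Real.logb 2 x) ^ 2)))
    ∩ Set.Icc 0 1

/-- The dyadic scale `l_x = ⌊log₂(‖αx‖ x² log₂² x / (2ε))⌋`. -/
noncomputable def lx (α ε : ℝ) (x : ℕ) : ℤ :=
  ⌊Real.logb 2 (nint (α * x) * (x : ℝ) ^ 2 * (Real.logb 2 x) ^ 2 / (2 * ε))⌋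

/-- `A(x)`: the union of all dyadic intervals of length `2^{-l_x}` at scale `l_x`
that meet `E(x)` (the smallest union of such intervals covering `E(x)`). -/
noncomputable def Aset (α ε : ℝ) (x : ℕ) : Set ℝ :=
  ⋃ a : ℤ, ⋃ _ : (Set.Icc ((a : ℝ) / (2 : ℝ) ^ lx α ε x) (((a : ℝ) + 1) / (2 : ℝ) ^ lx α ε x)
      ∩ Eset α ε x).Nonempty,
    Set.Icc ((a : ℝ) / (2 : ℝ) ^ lx α ε x) (((a : ℝ) + 1) / (2 : ℝ) ^ lx α ε x)

/-- `A^c(x) = [0,1] \ A(x)`. -/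
noncomputable def Acset (α ε : ℝ) (x : ℕ) : Set ℝ := Set.Icc 0 1 \ Aset α ε x

/-- `B_q = ⋂_{x=q₀}^{q} A^c(x)`. -/
noncomputable def Bset (α ε : ℝ) (q₀ q : ℕ) : Set ℝ := ⋂ x ∈ Finset.Icc q₀ q, Acset α ε x

theorem nint_nonneg (t : ℝ) : 0 ≤ nint t := abs_nonneg _

theorem nint_le_abs_sub_intCast (t : ℝ) (m : ℤ) : nint t ≤ |t - m| := round_le t m

theorem nint_le_half (t : ℝ) : nint t ≤ 1 / 2 := abs_sub_round t

/-- Two multiples of `α` by distinct naturals below `X` are at distance more than `δ / X` mod `1`. -/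
theorem lt_abs_sub_of_badlyApproximable {α δ : ℝ} (hδ0 : 0 < δ)
    (hbad : ∀ n : ℕ, 0 < n → δ ≤ (n : ℝ) * nint (α * n)) {X x y : ℕ} (hx : x < X) (hyx : y < x) :
    δ / X < |(α * x - round (α * x)) - (α * y - round (α * y))| := by
  have hn : 0 < x - y := by omega
  have h1 := hbad (x - y) hn
  have h2 := nint_le_abs_sub_intCast (α * (x - y : ℕ)) (round (α * x) - round (α * y))
  have h3 : (α * x - round (α * x)) - (α * y - round (α * y))
      = α * (x - y : ℕ) - ((round (α * x) - round (α * y) : ℤ) : ℝ) := by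
    push_cast [hyx.le]; ring
  rw [h3]
  refine lt_of_lt_of_le ?_ h2
  have hnX : ((x - y : ℕ) : ℝ) < X := by exact_mod_cast (by omega)
  have hn' : (0 : ℝ) < ((x - y : ℕ) : ℝ) := by exact_mod_cast hn
  rw [div_lt_iff₀ (hn'.trans hnX)]
  have hpos : 0 < nint (α * (x - y : ℕ)) := by
    by_contra hneg
    nlinarith
  nlinarith

theorem sum_one_div_le_one_add_log {ι : Type*} (s : Finset ι) (f : ι → ℕ) (hf : Set.InjOn f s)
    (M : ℕ) (hM : ∀ i ∈ s, f i ∈ Finset.Icc 1 M) :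
    ∑ i ∈ s, 1 / (f i : ℝ) ≤ 1 + Real.log M := by
  calc ∑ i ∈ s, 1 / (f i : ℝ) = ∑ m ∈ s.image f, 1 / (m : ℝ) := (Finset.sum_image (f := fun m : ℕ => 1 / (m : ℝ)) hf).symm
    _ ≤ ∑ m ∈ Finset.Icc 1 M, 1 / (m : ℝ) :=
        Finset.sum_le_sum_of_subset_of_nonneg
          (Finset.image_subset_iff.2 hM) (fun _ _ _ => by positivity)
    _ = (harmonic M : ℝ) := by simp [harmonic_eq_sum_Icc]
    _ ≤ 1 + Real.log M := harmonic_le_one_add_log M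

/-- Sum of reciprocals of a `1`-separated family of reals in `[1, M]`. -/
theorem sum_one_div_le_of_separated {ι : Type*} (s : Finset ι) (v : ι → ℝ) (M : ℕ)
    (h1 : ∀ i ∈ s, 1 ≤ v i) (hM : ∀ i ∈ s, v i ≤ M)
    (hsep : ∀ i ∈ s, ∀ j ∈ s, i ≠ j → 1 ≤ |v i - v j|) :
    ∑ i ∈ s, 1 / v i ≤ 1 + Real.log M := by
  refine le_trans (Finset.sum_le_sum (g := fun i => 1 / (⌊v i⌋₊ : ℝ)) fun i hi => ?_)
    (sum_one_div_le_one_add_log s (fun i => ⌊v i⌋₊) (fun i hi j hj hij => ?_) M fun i hi => ?_)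
  · have hfl : 1 ≤ ⌊v i⌋₊ := Nat.le_floor (by simpa using h1 i hi)
    have hfl' : (0 : ℝ) < (⌊v i⌋₊ : ℝ) := by exact_mod_cast hfl
    exact one_div_le_one_div_of_le hfl' (Nat.floor_le (zero_le_one.trans (h1 i hi)))
  · by_contra hne
    have hs := hsep i hi j hj hne
    have a1 := Nat.floor_le (zero_le_one.trans (h1 i hi))
    have a2 := Nat.lt_floor_add_one (v i)
    have b1 := Nat.floor_le (zero_le_one.trans (h1 j hj))
    have b2 := Nat.lt_floor_add_one (v j)
    have hij' : ((⌊v i⌋₊ : ℕ) : ℝ) = ⌊v j⌋₊ := by exact_mod_cast hij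
    rcases le_abs.1 hs with h | h <;> linarith
  · exact Finset.mem_Icc.2 ⟨Nat.le_floor (by simpa using h1 i hi), Nat.floor_le_of_le (hM i hi)⟩

theorem sum_one_div_nint_le {α δ : ℝ} (hδ0 : 0 < δ)
    (hbad : ∀ n : ℕ, 0 < n → δ ≤ (n : ℝ) * nint (α * n)) {D : ℕ} (hD : 1 / δ ≤ D) (X : ℕ) :
    ∑ x ∈ Finset.Ico 1 X, 1 / nint (α * x) ≤ 2 * (X / δ) * (1 + Real.log (X * D)) := by
  rcases Nat.eq_zero_or_pos X with rfl | hX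
  · simp
  have hXr : (0 : ℝ) < X := by exact_mod_cast hX
  set u : ℕ → ℝ := fun x => α * x - round (α * x) with hu
  set v : ℕ → ℝ := fun x => u x * (X / δ) with hv
  have hc : 0 < (X : ℝ) / δ := by positivity
  have hone : δ / X * (X / δ) = 1 := by field_simp
  have hsep : ∀ x ∈ Finset.Ico 1 X, ∀ y ∈ Finset.Ico 1 X, x ≠ y → 1 ≤ |v x - v y| := by
    have key : ∀ x ∈ Finset.Ico 1 X, ∀ y, y < x → 1 ≤ |v x - v y| := by
      intro x hx y hyx
      have := lt_abs_sub_of_badlyApproximable hδ0 hbad (Finset.mem_Ico.1 hx).2 hyx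
      rw [hv]
      simp only
      rw [← sub_mul, abs_mul, abs_of_pos hc, ← hone]
      exact mul_le_mul_of_nonneg_right this.le hc.le
    intro x hx y hy hxy
    rcases lt_or_gt_of_ne hxy with h | h
    · rw [abs_sub_comm]; exact key y hy x h
    · exact key x hx y h
  have habs : ∀ x, |v x| = nint (α * x) * (X / δ) := by
    intro x
    simp only [hv, abs_mul, abs_of_pos hc]
    rfl
  have hge : ∀ x ∈ Finset.Ico 1 X, 1 ≤ |v x| := by
    intro x hx
    obtain ⟨hx1, hx2⟩ := Finset.mem_Ico.1 hx
    rw [habs, ← hone]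
    refine mul_le_mul_of_nonneg_right ?_ hc.le
    rw [div_le_iff₀ hXr]
    have hxX : (x : ℝ) ≤ X := by exact_mod_cast hx2.le
    nlinarith [hbad x hx1, nint_nonneg (α * x)]
  have hle : ∀ x, |v x| ≤ (X * D : ℕ) := by
    intro x
    rw [habs]
    push_cast
    have h1 := nint_le_half (α * x)
    have h2 : (X : ℝ) / δ ≤ X * D := by
      rw [div_eq_mul_one_div]
      exact mul_le_mul_of_nonneg_left hD hXr.le
    nlinarith
  have hsum : ∑ x ∈ Finset.Ico 1 X, 1 / nint (α * x)
      = X / δ * ∑ x ∈ Finset.Ico 1 X, 1 / |v x| := by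
    rw [Finset.mul_sum]
    refine Finset.sum_congr rfl fun x _ => ?_
    rw [habs]
    field_simp
  have hpos : ∑ x ∈ Finset.Ico 1 X with 0 ≤ v x, 1 / |v x| ≤ 1 + Real.log (X * D : ℕ) := by
    rw [Finset.sum_congr rfl (g := fun x => 1 / v x)
      (fun x hx => by rw [abs_of_nonneg (Finset.mem_filter.1 hx).2])]
    refine sum_one_div_le_of_separated _ _ _ (fun x hx => ?_) (fun x hx => ?_)
      fun x hx y hy => hsep x (Finset.mem_filter.1 hx).1 y (Finset.mem_filter.1 hy).1
    · simpa [abs_of_nonneg (Finset.mem_filter.1 hx).2] using hge x (Finset.mem_filter.1 hx).1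
    · exact (le_abs_self _).trans (hle x)
  have hneg : ∑ x ∈ Finset.Ico 1 X with ¬ 0 ≤ v x, 1 / |v x| ≤ 1 + Real.log (X * D : ℕ) := by
    rw [Finset.sum_congr rfl (g := fun x => 1 / (-v x))
      (fun x hx => by rw [abs_of_neg (not_le.1 (Finset.mem_filter.1 hx).2)])]
    refine sum_one_div_le_of_separated _ _ _ (fun x hx => ?_) (fun x hx => ?_)
      fun x hx y hy hxy => ?_
    · have := hge x (Finset.mem_filter.1 hx).1
      rwa [abs_of_neg (not_le.1 (Finset.mem_filter.1 hx).2)] at this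
    · exact (neg_le_abs _).trans (hle x)
    · have := hsep x (Finset.mem_filter.1 hx).1 y (Finset.mem_filter.1 hy).1 hxy
      rwa [neg_sub_neg, abs_sub_comm]
  rw [hsum, ← Finset.sum_filter_add_sum_filter_not _ (fun x => 0 ≤ v x)]
  push_cast at hpos hneg
  calc _ ≤ X / δ * ((1 + Real.log (X * D)) + (1 + Real.log (X * D))) :=
        mul_le_mul_of_nonneg_left (add_le_add hpos hneg) hc.le
    _ = _ := by ring

/-- For badly approximable `α`, the sum of `1 / (x ‖α x‖)` up to `2 ^ K` is `O(K ^ 2)`. -/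
theorem exists_sum_one_div_mul_nint_le {α δ : ℝ} (hδ0 : 0 < δ)
    (hbad : ∀ n : ℕ, 0 < n → δ ≤ (n : ℝ) * nint (α * n)) :
    ∃ C : ℝ, 0 < C ∧ ∀ K : ℕ,
      ∑ x ∈ Finset.Ico 1 (2 ^ K : ℕ), 1 / ((x : ℝ) * nint (α * x)) ≤ C * (K : ℝ) ^ 2 := by
  obtain ⟨D, hD⟩ := exists_nat_ge (1 / δ)
  have hDpos : (0 : ℝ) < D := lt_of_lt_of_le (by positivity) hD
  have hD1 : (1 : ℝ) ≤ D := by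
    have : 0 < D := by exact_mod_cast hDpos
    exact_mod_cast this
  have hlogD := Real.log_nonneg hD1
  refine ⟨4 / δ * (2 + Real.log D), by positivity, fun K => ?_⟩
  induction K with
  | zero => simp
  | succ K ih =>
    have hsplit := Finset.sum_Ico_consecutive (fun x : ℕ => 1 / ((x : ℝ) * nint (α * x)))
      (Nat.one_le_two_pow (n := K)) (Nat.pow_le_pow_right two_pos (Nat.le_succ K))
    rw [← hsplit]
    have hblock : ∑ x ∈ Finset.Ico (2 ^ K : ℕ) (2 ^ (K + 1)), 1 / ((x : ℝ) * nint (α * x))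
        ≤ 4 / δ * (2 + Real.log D) * (K + 1) := by
      calc ∑ x ∈ Finset.Ico (2 ^ K : ℕ) (2 ^ (K + 1)), 1 / ((x : ℝ) * nint (α * x))
          ≤ ∑ x ∈ Finset.Ico (2 ^ K : ℕ) (2 ^ (K + 1)), 1 / (2 : ℝ) ^ K * (1 / nint (α * x)) := by
            refine Finset.sum_le_sum fun x hx => ?_
            have hx' : (2 : ℝ) ^ K ≤ x := by exact_mod_cast (Finset.mem_Ico.1 hx).1
            rw [← one_div_mul_one_div]
            exact mul_le_mul_of_nonneg_right (one_div_le_one_div_of_le (by positivity) hx')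
              (one_div_nonneg.2 (nint_nonneg _))
        _ ≤ ∑ x ∈ Finset.Ico 1 (2 ^ (K + 1) : ℕ), 1 / (2 : ℝ) ^ K * (1 / nint (α * x)) :=
            Finset.sum_le_sum_of_subset_of_nonneg
              (Finset.Ico_subset_Ico_left Nat.one_le_two_pow)
              fun x _ _ => mul_nonneg (by positivity) (one_div_nonneg.2 (nint_nonneg _))
        _ ≤ 1 / (2 : ℝ) ^ K * (2 * ((2 : ℝ) ^ (K + 1) / δ)
              * (1 + Real.log ((2 : ℝ) ^ (K + 1) * D))) := by
            rw [← Finset.mul_sum]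
            refine mul_le_mul_of_nonneg_left ?_ (by positivity)
            simpa using sum_one_div_nint_le hδ0 hbad hD (2 ^ (K + 1))
        _ = 4 / δ * (1 + ((K + 1) * Real.log 2 + Real.log D)) := by
            rw [Real.log_mul (by positivity) hDpos.ne', Real.log_pow]
            push_cast
            field_simp
            ring
        _ ≤ 4 / δ * ((2 + Real.log D) * (K + 1)) := by
            refine mul_le_mul_of_nonneg_left ?_ (by positivity)
            have h2 : Real.log 2 ≤ 1 := by linarith [Real.log_two_lt_d9]
            have hK : (0 : ℝ) ≤ K := Nat.cast_nonneg K
            nlinarith [mul_nonneg hK hlogD]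
        _ = _ := by ring
    have hC : 0 < 4 / δ * (2 + Real.log D) := by positivity
    have hK : (0 : ℝ) ≤ K := Nat.cast_nonneg K
    push_cast
    nlinarith [mul_nonneg hC.le hK]

/-- An open dyadic interval of a finer scale meeting a closed dyadic one is contained in it. -/
theorem Ioo_subset_Icc_of_dyadic {l : ℤ} {L : ℕ} (hl : l ≤ L) {a b : ℤ} {θ : ℝ}
    (hθ : θ ∈ Set.Ioo ((b : ℝ) / 2 ^ L) ((b + 1) / 2 ^ L))
    (hθ' : θ ∈ Set.Icc ((a : ℝ) / (2 : ℝ) ^ l) ((a + 1) / (2 : ℝ) ^ l)) :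
    Set.Ioo ((b : ℝ) / 2 ^ L) ((b + 1) / 2 ^ L)
      ⊆ Set.Icc ((a : ℝ) / (2 : ℝ) ^ l) ((a + 1) / (2 : ℝ) ^ l) := by
  obtain ⟨m, hm⟩ := Int.le.dest hl
  have hpow : (2 : ℝ) ^ L = (2 : ℝ) ^ l * ((2 ^ m : ℤ) : ℝ) := by
    rw [← zpow_natCast, ← hm, zpow_add₀ two_ne_zero]
    simp
  have hP : (0 : ℝ) < (2 : ℝ) ^ l := by positivity
  have hM : (0 : ℝ) < ((2 ^ m : ℤ) : ℝ) := by positivity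
  generalize (2 ^ m : ℤ) = M at *
  rw [hpow] at hθ ⊢
  have e1 : (a : ℝ) / (2 : ℝ) ^ l = (a * M : ℤ) / ((2 : ℝ) ^ l * M) := by
    push_cast; field_simp
  have e2 : ((a : ℝ) + 1) / (2 : ℝ) ^ l = ((a + 1) * M : ℤ) / ((2 : ℝ) ^ l * M) := by
    push_cast; field_simp
  rw [e1, e2] at hθ' ⊢
  have hPM : 0 < (2 : ℝ) ^ l * M := mul_pos hP hM
  have h1 : a * M < b + 1 := by
    have := hθ'.1.trans_lt hθ.2
    rw [div_lt_div_iff_of_pos_right hPM] at this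
    exact_mod_cast this
  have h2 : b < (a + 1) * M := by
    have := hθ.1.trans_le hθ'.2
    rw [div_lt_div_iff_of_pos_right hPM] at this
    exact_mod_cast this
  have h3 : ((a * M : ℤ) : ℝ) ≤ b := by exact_mod_cast Int.lt_add_one_iff.1 h1
  have h4 : (b : ℝ) + 1 ≤ ((a + 1) * M : ℤ) := by exact_mod_cast Int.add_one_le_iff.2 h2
  exact Set.Ioo_subset_Icc_self.trans (Set.Icc_subset_Icc
    (div_le_div_of_nonneg_right h3 hPM.le) (div_le_div_of_nonneg_right h4 hPM.le))

/-- If every scale up to `q` is at most `L`, then `B_q` contains every open dyadic interval of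
scale `L` that it meets. -/
theorem Ioo_subset_Bset {α ε : ℝ} {q₀ q L : ℕ} (hL : ∀ x ∈ Finset.Icc q₀ q, lx α ε x ≤ L)
    {b : ℤ} {θ : ℝ} (hθ : θ ∈ Set.Ioo ((b : ℝ) / 2 ^ L) ((b + 1) / 2 ^ L))
    (hB : θ ∈ Bset α ε q₀ q) :
    Set.Ioo ((b : ℝ) / 2 ^ L) ((b + 1) / 2 ^ L) ⊆ Bset α ε q₀ q := by
  intro t ht
  simp only [Bset, Set.mem_iInter] at hB ⊢
  intro x hx
  refine ⟨?_, fun hA => (hB x hx).2 ?_⟩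
  · have h01 : Set.Ioo ((b : ℝ) / 2 ^ L) ((b + 1) / 2 ^ L)
        ⊆ Set.Icc (((0 : ℤ) : ℝ) / (2 : ℝ) ^ (0 : ℤ)) (((0 : ℤ) + 1) / (2 : ℝ) ^ (0 : ℤ)) :=
      Ioo_subset_Icc_of_dyadic (by positivity) hθ (by simpa using (hB x hx).1)
    simpa using h01 ht
  · simp only [Aset, Set.mem_iUnion] at hA ⊢
    obtain ⟨a, ha, hta⟩ := hA
    exact ⟨a, ha, Ioo_subset_Icc_of_dyadic (hL x hx) ht hta hθ⟩

/-- `A(x)` is contained in the union of the balls of radius `5ε / (‖αx‖ x² log₂² x)` around the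
fractions with denominator `x`. -/
theorem Aset_subset_iUnion_closedBall {α ε : ℝ} (hε : 0 < ε) {x : ℕ}
    (hN : 0 < nint (α * x) * (x : ℝ) ^ 2 * (Real.logb 2 x) ^ 2) :
    Aset α ε x ⊆ ⋃ y : ℤ, Metric.closedBall ((y : ℝ) / x)
      (5 * (ε / (nint (α * x) * (x : ℝ) ^ 2 * (Real.logb 2 x) ^ 2))) := by
  intro t ht
  simp only [Aset, Set.mem_iUnion] at ht
  obtain ⟨a, ⟨s, hs, hsE⟩, hta⟩ := ht
  simp only [Eset, Set.mem_inter_iff, Set.mem_iUnion] at hsE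
  obtain ⟨⟨y, _, hy⟩, _⟩ := hsE
  have hscale : 1 / (2 : ℝ) ^ lx α ε x
      ≤ 4 * (ε / (nint (α * x) * (x : ℝ) ^ 2 * (Real.logb 2 x) ^ 2)) := by
    have hfl := Int.lt_floor_add_one
      (Real.logb 2 (nint (α * x) * (x : ℝ) ^ 2 * (Real.logb 2 x) ^ 2 / (2 * ε)))
    rw [Real.logb_lt_iff_lt_rpow one_lt_two (by positivity), Real.rpow_add two_pos,
      Real.rpow_intCast, Real.rpow_one, div_lt_iff₀ (by positivity)] at hfl
    have hP : (0 : ℝ) < 2 ^ lx α ε x := by positivity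
    rw [← mul_div_assoc, div_le_div_iff₀ hP hN]
    unfold lx
    linarith
  generalize nint (α * x) * (x : ℝ) ^ 2 * (Real.logb 2 x) ^ 2 = N at *
  rw [add_div] at hs hta
  refine Set.mem_iUnion.2 ⟨y, ?_⟩
  rw [Real.closedBall_eq_Icc]
  push_cast
  obtain ⟨h1, h2⟩ := hs
  obtain ⟨h3, h4⟩ := hta
  obtain ⟨h5, h6⟩ := hy
  constructor <;> linarith

theorem card_Icc_ceil_floor_le {a b : ℝ} (hab : a ≤ b) :
    ((Finset.Icc ⌈a⌉ ⌊b⌋).card : ℝ) ≤ b - a + 1 := by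
  rw [Int.card_Icc]
  rcases le_total 0 (⌊b⌋ + 1 - ⌈a⌉) with h | h
  · have : (((⌊b⌋ + 1 - ⌈a⌉).toNat : ℤ) : ℝ) = ((⌊b⌋ + 1 - ⌈a⌉ : ℤ) : ℝ) := by
      rw [Int.toNat_of_nonneg h]
    rw [← Int.cast_natCast, this]
    push_cast
    linarith [Int.floor_le b, Int.le_ceil a]
  · rw [Int.toNat_of_nonpos h]
    simp
    linarith

theorem volume_iUnion_closedBall_inter_Ioo_le {x : ℕ} (hx : 0 < x) {ρ c w : ℝ} (hρ : 0 ≤ ρ)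
    (hw : 0 ≤ w) :
    volume ((⋃ y : ℤ, Metric.closedBall ((y : ℝ) / x) ρ) ∩ Set.Ioo c (c + w))
      ≤ ENNReal.ofReal ((x * (w + 2 * ρ) + 1) * (2 * ρ)) := by
  have hxr : (0 : ℝ) < x := by exact_mod_cast hx
  have hcard := card_Icc_ceil_floor_le (a := x * (c - ρ)) (b := x * (c + w + ρ)) (by gcongr; linarith)
  have hsub : (⋃ y : ℤ, Metric.closedBall ((y : ℝ) / x) ρ) ∩ Set.Ioo c (c + w)
      ⊆ ⋃ y ∈ Finset.Icc ⌈x * (c - ρ)⌉ ⌊x * (c + w + ρ)⌋, Metric.closedBall ((y : ℝ) / x) ρ := by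
    rintro t ⟨ht, h1, h2⟩
    obtain ⟨y, hy⟩ := Set.mem_iUnion.1 ht
    refine Set.mem_iUnion₂.2 ⟨y, ?_, hy⟩
    rw [Real.closedBall_eq_Icc] at hy
    rw [Finset.mem_Icc, Int.ceil_le, Int.le_floor, ← le_div_iff₀' hxr, ← div_le_iff₀' hxr]
    constructor <;> linarith [hy.1, hy.2]
  calc _ ≤ _ := measure_mono hsub
    _ ≤ ∑ y ∈ Finset.Icc ⌈x * (c - ρ)⌉ ⌊x * (c + w + ρ)⌋,
          volume (Metric.closedBall ((y : ℝ) / x) ρ) := measure_biUnion_finset_le _ _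
    _ = ENNReal.ofReal (((Finset.Icc ⌈x * (c - ρ)⌉ ⌊x * (c + w + ρ)⌋).card : ℝ) * (2 * ρ)) := by
        simp only [Real.volume_closedBall, Finset.sum_const, nsmul_eq_mul]
        rw [ENNReal.ofReal_mul (Nat.cast_nonneg _), ENNReal.ofReal_natCast]
    _ ≤ _ := by
        refine ENNReal.ofReal_le_ofReal (mul_le_mul_of_nonneg_right (hcard.trans ?_) (by linarith))
        linarith

/-- A set which contains every open dyadic interval of scale `L` it meets inherits a bound for the
relative measure of `A` from those intervals. -/
theorem volume_inter_le_of_Ioo {B A : Set ℝ} {L : ℕ} {k : ENNReal}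
    (hB : ∀ b : ℤ, ∀ θ ∈ Set.Ioo ((b : ℝ) / 2 ^ L) ((b + 1) / 2 ^ L), θ ∈ B →
      Set.Ioo ((b : ℝ) / 2 ^ L) ((b + 1) / 2 ^ L) ⊆ B)
    (hA : ∀ b : ℤ, volume (A ∩ Set.Ioo ((b : ℝ) / 2 ^ L) ((b + 1) / 2 ^ L))
      ≤ k * volume (Set.Ioo ((b : ℝ) / 2 ^ L) ((b + 1) / 2 ^ L))) :
    volume (B ∩ A) ≤ k * volume B := by
  have hw : (0 : ℝ) < 1 / 2 ^ L := by positivity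
  have hsplit : ∀ S : Set ℝ,
      volume S = ∑' b : ℤ, volume (Set.Ioo ((b : ℝ) / 2 ^ L) ((b + 1) / 2 ^ L) ∩ S) := by
    intro S
    have hun := iUnion_Ico_zsmul hw
    have hdis := Set.pairwise_disjoint_Ico_zsmul (1 / 2 ^ L : ℝ)
    rw [← Measure.restrict_apply_univ, ← hun, measure_iUnion hdis fun _ => measurableSet_Ico]
    refine tsum_congr fun b => ?_
    rw [Measure.restrict_apply measurableSet_Ico]
    have e1 : b • (1 / 2 ^ L : ℝ) = b / 2 ^ L := by rw [zsmul_eq_mul]; ring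
    have e2 : (b + 1) • (1 / 2 ^ L : ℝ) = (b + 1) / 2 ^ L := by
      rw [zsmul_eq_mul]; push_cast; ring
    rw [e1, e2]
    exact measure_congr (Ioo_ae_eq_Ico.symm.inter (ae_eq_refl S))
  rw [hsplit B, hsplit (B ∩ A), ← ENNReal.tsum_mul_left]
  refine ENNReal.tsum_le_tsum fun b => ?_
  rcases Set.eq_empty_or_nonempty (Set.Ioo ((b : ℝ) / 2 ^ L) ((b + 1) / 2 ^ L) ∩ B) with h | h
  · rw [← Set.inter_assoc, h]
    simp
  · obtain ⟨θ, hθ, hθB⟩ := h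
    rw [Set.inter_eq_left.2 (hB b θ hθ hθB)]
    refine le_trans (measure_mono ?_) (hA b)
    rintro t ⟨h1, _, h2⟩
    exact ⟨h2, h1⟩

theorem nint_pos_of_badlyApproximable {α δ : ℝ} (hδ0 : 0 < δ)
    (hbad : ∀ n : ℕ, 0 < n → δ ≤ (n : ℝ) * nint (α * n)) {x : ℕ} (hx : 0 < x) :
    0 < nint (α * x) :=
  pos_of_mul_pos_right (hδ0.trans_le (hbad x hx)) (Nat.cast_nonneg x)

theorem one_le_logb_two {x : ℕ} (hx : 2 ≤ x) : 1 ≤ Real.logb 2 x := by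
  rw [Real.le_logb_iff_rpow_le one_lt_two (by positivity), Real.rpow_one]
  exact_mod_cast hx

/-- The scales `l_x`, `x ≤ q`, are bounded by the one of `q² log₂² q / (4ε)`. -/
theorem lx_le {α δ ε : ℝ} (hδ0 : 0 < δ)
    (hbad : ∀ n : ℕ, 0 < n → δ ≤ (n : ℝ) * nint (α * n)) (hε : 0 < ε) {x q : ℕ} (hx : 2 ≤ x)
    (hxq : x ≤ q) :
    lx α ε x ≤ ⌊Real.logb 2 ((q : ℝ) ^ 2 * (Real.logb 2 q) ^ 2 / (4 * ε))⌋ := by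
  have hn := nint_pos_of_badlyApproximable hδ0 hbad (by omega : 0 < x)
  have hlog := one_le_logb_two hx
  have hx0 : (0 : ℝ) < x := by positivity
  have hxq' : (x : ℝ) ≤ q := by exact_mod_cast hxq
  have hlogq : Real.logb 2 x ≤ Real.logb 2 q := Real.logb_le_logb_of_le one_lt_two hx0 hxq'
  refine Int.floor_le_floor (Real.logb_le_logb_of_le one_lt_two (by positivity) ?_)
  calc nint (α * x) * (x : ℝ) ^ 2 * (Real.logb 2 x) ^ 2 / (2 * ε)
      ≤ 1 / 2 * (q : ℝ) ^ 2 * (Real.logb 2 q) ^ 2 / (2 * ε) := by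
        gcongr
        exact nint_le_half _
    _ = _ := by ring

theorem volume_Bset_inter_Aset_le {α δ ε : ℝ} (hδ0 : 0 < δ)
    (hbad : ∀ n : ℕ, 0 < n → δ ≤ (n : ℝ) * nint (α * n)) (hε : 0 < ε) (hεδ : ε ≤ δ / 10)
    {q₀ q x : ℕ} (hq₀ : 2 ≤ q₀) (hx : 2 ≤ x)
    (hq : 1 ≤ (q : ℝ) ^ 2 * (Real.logb 2 q) ^ 2 / (4 * ε))
    (hqx : (q : ℝ) ^ 2 * (Real.logb 2 q) ^ 2 / (4 * ε) ≤ x) :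
    volume (Bset α ε q₀ q ∩ Aset α ε x)
      ≤ ENNReal.ofReal (30 * ε / (Real.logb 2 x) ^ 2 * (1 / (x * nint (α * x))))
        * volume (Bset α ε q₀ q) := by
  have hn := nint_pos_of_badlyApproximable hδ0 hbad (by omega : 0 < x)
  have hlog := one_le_logb_two hx
  have hx0 : (0 : ℝ) < x := by positivity
  have hN : 0 < nint (α * x) * (x : ℝ) ^ 2 * (Real.logb 2 x) ^ 2 := by positivity
  have hA := Aset_subset_iUnion_closedBall hε hN
  set Z := (q : ℝ) ^ 2 * (Real.logb 2 q) ^ 2 / (4 * ε) with hZ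
  obtain ⟨L, hL⟩ : ∃ L : ℕ, (L : ℤ) = ⌊Real.logb 2 Z⌋ :=
    ⟨_, Int.toNat_of_nonneg (Int.floor_nonneg.2 (Real.logb_nonneg one_lt_two hq))⟩
  have hLx : (2 : ℝ) ^ L ≤ x := by
    refine le_trans ?_ hqx
    have hfl := Int.floor_le (Real.logb 2 Z)
    rw [← hL, Real.le_logb_iff_rpow_le one_lt_two (by positivity)] at hfl
    simpa using hfl
  set r := ε / (nint (α * x) * (x : ℝ) ^ 2 * (Real.logb 2 x) ^ 2) with hr
  have hr0 : 0 < r := by positivity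
  have hxr : x * (10 * r) ≤ 1 := by
    have hb := hbad x (by omega)
    have h1 : x * (10 * r) = 10 * ε / ((x * nint (α * x)) * (Real.logb 2 x) ^ 2) := by
      rw [hr]; field_simp
    rw [h1, div_le_one (by positivity)]
    nlinarith [one_le_pow₀ hlog (n := 2)]
  have hk : 30 * ε / (Real.logb 2 x) ^ 2 * (1 / (x * nint (α * x))) = 30 * (x * r) := by
    rw [hr]; field_simp
  rw [hk]
  refine volume_inter_le_of_Ioo (L := L) (fun b θ hθ hθB => Ioo_subset_Bset (fun y hy => ?_) hθ hθB)
    fun b => ?_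
  · rw [hL]
    obtain ⟨hy1, hy2⟩ := Finset.mem_Icc.1 hy
    exact lx_le hδ0 hbad hε (hq₀.trans hy1) hy2
  · have hw : (0 : ℝ) < 1 / 2 ^ L := by positivity
    have hxw : 1 ≤ x * (1 / (2 : ℝ) ^ L) := by
      rw [mul_one_div, one_le_div (by positivity)]
      exact hLx
    have hadd : ((b : ℝ) + 1) / 2 ^ L = b / 2 ^ L + 1 / 2 ^ L := add_div _ _ _
    rw [hadd]
    refine (measure_mono (Set.inter_subset_inter_left _ hA)).trans
      ((volume_iUnion_closedBall_inter_Ioo_le (by omega) (by positivity) hw.le).trans ?_)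
    rw [Real.volume_Ioo, ← ENNReal.ofReal_mul (by positivity)]
    refine ENNReal.ofReal_le_ofReal ?_
    generalize 1 / (2 : ℝ) ^ L = w at *
    calc (x * (w + 2 * (5 * r)) + 1) * (2 * (5 * r))
        = (x * w + x * (10 * r) + 1) * (10 * r) := by ring
      _ ≤ (x * w + x * w + x * w) * (10 * r) := by
          refine mul_le_mul_of_nonneg_right ?_ (by positivity)
          linarith
      _ = _ := by ring

theorem Bset_subset_union {α ε : ℝ} {q₀ q₁ q₂ : ℕ} (h₀ : q₀ ≤ q₂) (h : q₁ ≤ q₂) (q₃ : ℕ) :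
    Bset α ε q₀ q₂
      ⊆ Bset α ε q₀ q₃ ∪ ⋃ x ∈ Finset.Ioc q₂ q₃, (Bset α ε q₀ q₁ ∩ Aset α ε x) := by
  intro t ht
  by_cases hA : ∃ x ∈ Finset.Ioc q₂ q₃, t ∈ Aset α ε x
  · obtain ⟨x, hx, htx⟩ := hA
    refine Or.inr (Set.mem_iUnion₂.2 ⟨x, hx, ?_, htx⟩)
    exact Set.biInter_subset_biInter_left (Finset.Icc_subset_Icc_right h) ht
  · left
    simp only [Bset, Set.mem_iInter] at ht ⊢
    intro x hx
    rw [Finset.mem_Icc] at hx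
    by_cases hxq : x ≤ q₂
    · exact ht x (Finset.mem_Icc.2 ⟨hx.1, hxq⟩)
    · exact ⟨(ht q₀ (Finset.mem_Icc.2 ⟨le_rfl, h₀⟩)).1,
        fun htx => hA ⟨x, Finset.mem_Ioc.2 ⟨not_le.1 hxq, hx.2⟩, htx⟩⟩

theorem sum_Ioc_cube_le {α C ε : ℝ} (hε : 0 < ε)
    (hC : ∀ K : ℕ, ∑ x ∈ Finset.Ico 1 (2 ^ K : ℕ), 1 / ((x : ℝ) * nint (α * x)) ≤ C * (K : ℝ) ^ 2)
    {q : ℕ} (hq : 2 ≤ q) :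
    ∑ x ∈ Finset.Ioc q (q ^ 3), 30 * ε / (Real.logb 2 x) ^ 2 * (1 / (x * nint (α * x)))
      ≤ 480 * (C * ε) := by
  have hC0 : 0 ≤ C := by simpa using hC 1 |>.trans' (Finset.sum_nonneg fun x _ =>
    one_div_nonneg.2 (mul_nonneg (Nat.cast_nonneg x) (nint_nonneg _)))
  have hlog := one_le_logb_two hq
  set ℓ := Real.logb 2 q with hℓ
  set K := ⌊3 * ℓ⌋₊ + 1 with hK
  have hK4 : (K : ℝ) ≤ 4 * ℓ := by
    have := Nat.floor_le (by linarith : 0 ≤ 3 * ℓ)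
    rw [hK]; push_cast; linarith
  have hqK : q ^ 3 < 2 ^ K := by
    have h := Nat.lt_floor_add_one (3 * ℓ)
    have h3 : 3 * ℓ = Real.logb 2 ((q : ℝ) ^ 3) := by rw [Real.logb_pow, hℓ]; norm_num
    have hK' : ((⌊3 * ℓ⌋₊ : ℝ) + 1) = (K : ℕ) := by rw [hK]; push_cast; rfl
    rw [hK', h3, Real.logb_lt_iff_lt_rpow one_lt_two (by positivity), Real.rpow_natCast] at h
    exact_mod_cast h
  calc ∑ x ∈ Finset.Ioc q (q ^ 3), 30 * ε / (Real.logb 2 x) ^ 2 * (1 / (x * nint (α * x)))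
      ≤ ∑ x ∈ Finset.Ioc q (q ^ 3), 30 * ε / ℓ ^ 2 * (1 / (x * nint (α * x))) := by
        refine Finset.sum_le_sum fun x hx => mul_le_mul_of_nonneg_right ?_
          (one_div_nonneg.2 (mul_nonneg (Nat.cast_nonneg x) (nint_nonneg _)))
        have hqx : (q : ℝ) ≤ x := by exact_mod_cast (Finset.mem_Ioc.1 hx).1.le
        have := Real.logb_le_logb_of_le one_lt_two (by positivity : (0 : ℝ) < q) hqx
        gcongr
    _ = 30 * ε / ℓ ^ 2 * ∑ x ∈ Finset.Ioc q (q ^ 3), 1 / ((x : ℝ) * nint (α * x)) :=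
        (Finset.mul_sum _ _ _).symm
    _ ≤ 30 * ε / ℓ ^ 2 * (C * (K : ℝ) ^ 2) := by
        refine mul_le_mul_of_nonneg_left (le_trans ?_ (hC K)) (by positivity)
        refine Finset.sum_le_sum_of_subset_of_nonneg (fun x hx => ?_) fun x _ _ =>
          one_div_nonneg.2 (mul_nonneg (Nat.cast_nonneg x) (nint_nonneg _))
        rw [Finset.mem_Ioc] at hx
        exact Finset.mem_Ico.2 ⟨by omega, hx.2.trans_lt hqK⟩
    _ ≤ 30 * ε / ℓ ^ 2 * (C * (4 * ℓ) ^ 2) := by gcongr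
    _ = 480 * (C * ε) := by field_simp; ring

theorem exists_logb_sq_le {c : ℝ} (hc : 0 < c) :
    ∃ Q : ℕ, ∀ q : ℕ, Q ≤ q → (Real.logb 2 q) ^ 2 ≤ c * q := by
  have hlog2 := Real.log_pos one_lt_two
  have h := (Real.isLittleO_pow_log_id_atTop (n := 2)).bound
    (mul_pos hc (pow_pos hlog2 2))
  have h' := tendsto_natCast_atTop_atTop.eventually h
  obtain ⟨Q, hQ⟩ := Filter.eventually_atTop.1 h'
  refine ⟨Q, fun q hq => ?_⟩
  have := hQ q hq
  simp only [id, Real.norm_eq_abs, abs_pow, sq_abs, Nat.abs_cast] at this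
  rw [Real.logb, div_pow, div_le_iff₀ (by positivity)]
  linarith

theorem Bset_measure_halving_step
    (α δ : ℝ) (hδ0 : 0 < δ) (hδ1 : δ < 1)
    (hbad : ∀ n : ℕ, 0 < n → δ ≤ (n : ℝ) * nint (α * n)) :
    ∃ ε₀ : ℝ, 0 < ε₀ ∧ ∀ ε : ℝ, 0 < ε → ε ≤ ε₀ →
      ∃ Q₀ : ℕ, ∀ q₀ : ℕ, Q₀ ≤ q₀ → ∀ q₁ q₂ q₃ : ℕ,
        q₀ ≤ q₁ → q₂ = q₁ ^ 3 → q₃ = q₂ ^ 3 →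
        (volume (Bset α ε q₀ q₁) / 2 ≤ volume (Bset α ε q₀ q₂) ∧
            0 < volume (Bset α ε q₀ q₁) / 2) →
        volume (Bset α ε q₀ q₂) / 2 ≤ volume (Bset α ε q₀ q₃) ∧
          0 < volume (Bset α ε q₀ q₂) / 2 := by
  obtain ⟨C, hC0, hC⟩ := exists_sum_one_div_mul_nint_le hδ0 hbad
  refine ⟨min (δ / 10) (1 / (1920 * C)), by positivity, fun ε hε hε₀ => ?_⟩
  have hεδ : ε ≤ δ / 10 := hε₀.trans (min_le_left _ _)
  have hCε : 480 * (C * ε) ≤ 1 / 4 := by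
    have := hε₀.trans (min_le_right _ _)
    rw [le_div_iff₀ (by positivity)] at this
    linarith
  obtain ⟨Q, hQ⟩ := exists_logb_sq_le (by positivity : 0 < 4 * ε)
  refine ⟨max Q 2, fun q₀ hq₀ q₁ q₂ q₃ hq₁ hq₂ hq₃ ⟨hhalf, hpos⟩ => ?_⟩
  have h2q₀ : 2 ≤ q₀ := (le_max_right _ _).trans hq₀
  have h2q₁ : 2 ≤ q₁ := h2q₀.trans hq₁
  have hq₁₂ : q₁ ≤ q₂ := hq₂ ▸ Nat.le_self_pow three_ne_zero q₁
  refine ⟨?_, ENNReal.div_pos (hpos.trans_le hhalf).ne' ENNReal.ofNat_ne_top⟩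
  have hlog := one_le_logb_two h2q₁
  have h2q₁' : (2 : ℝ) ≤ q₁ := by exact_mod_cast h2q₁
  have hZ1 : 1 ≤ (q₁ : ℝ) ^ 2 * (Real.logb 2 q₁) ^ 2 / (4 * ε) := by
    rw [one_le_div (by positivity)]
    nlinarith [one_le_pow₀ hlog (n := 2)]
  have hZ : (q₁ : ℝ) ^ 2 * (Real.logb 2 q₁) ^ 2 / (4 * ε) ≤ q₂ := by
    have := hQ q₁ ((le_max_left _ _).trans (hq₀.trans hq₁))
    rw [div_le_iff₀ (by positivity), hq₂]
    push_cast
    calc (q₁ : ℝ) ^ 2 * (Real.logb 2 q₁) ^ 2 ≤ (q₁ : ℝ) ^ 2 * (4 * ε * q₁) := by gcongr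
      _ = _ := by ring
  have hremoved : ∑ x ∈ Finset.Ioc q₂ q₃, volume (Bset α ε q₀ q₁ ∩ Aset α ε x)
      ≤ volume (Bset α ε q₀ q₂) / 2 := by
    calc ∑ x ∈ Finset.Ioc q₂ q₃, volume (Bset α ε q₀ q₁ ∩ Aset α ε x)
        ≤ ∑ x ∈ Finset.Ioc q₂ q₃,
            ENNReal.ofReal (30 * ε / (Real.logb 2 x) ^ 2 * (1 / (x * nint (α * x))))
              * volume (Bset α ε q₀ q₁) := by
          refine Finset.sum_le_sum fun x hx => ?_
          have hx' := (Finset.mem_Ioc.1 hx).1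
          have hxr : (q₂ : ℝ) ≤ x := by exact_mod_cast hx'.le
          exact volume_Bset_inter_Aset_le hδ0 hbad hε hεδ h2q₀ (by omega) hZ1 (hZ.trans hxr)
      _ = ENNReal.ofReal (∑ x ∈ Finset.Ioc q₂ q₃,
            30 * ε / (Real.logb 2 x) ^ 2 * (1 / (x * nint (α * x))))
              * volume (Bset α ε q₀ q₁) := by
          rw [← Finset.sum_mul, ENNReal.ofReal_sum_of_nonneg fun x _ => mul_nonneg (by positivity)
            (one_div_nonneg.2 (mul_nonneg (Nat.cast_nonneg x) (nint_nonneg _)))]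
      _ ≤ ENNReal.ofReal (1 / 4) * volume (Bset α ε q₀ q₁) := by
          gcongr
          rw [hq₃]
          exact (sum_Ioc_cube_le hε hC (h2q₁.trans hq₁₂)).trans hCε
      _ = volume (Bset α ε q₀ q₁) / 2 / 2 := by
          rw [ENNReal.div_eq_inv_mul, ENNReal.div_eq_inv_mul, ← mul_assoc,
            ENNReal.ofReal_div_of_pos four_pos]
          congr 1
          rw [← ENNReal.mul_inv (by simp) (by simp)]
          norm_num
      _ ≤ volume (Bset α ε q₀ q₂) / 2 := ENNReal.div_le_div_right hhalf 2
  have hfin : volume (Bset α ε q₀ q₂) ≠ ⊤ := by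
    have hsub : Bset α ε q₀ q₂ ⊆ Set.Icc 0 1 := fun t ht =>
      (Set.mem_iInter₂.1 ht q₀ (Finset.mem_Icc.2 ⟨le_rfl, hq₁.trans hq₁₂⟩)).1
    exact measure_ne_top_of_subset hsub (by simp)
  have hcover : volume (Bset α ε q₀ q₂)
      ≤ volume (Bset α ε q₀ q₃) + volume (Bset α ε q₀ q₂) / 2 :=
    calc volume (Bset α ε q₀ q₂)
        ≤ volume (Bset α ε q₀ q₃ ∪ ⋃ x ∈ Finset.Ioc q₂ q₃, (Bset α ε q₀ q₁ ∩ Aset α ε x)) :=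
          measure_mono (Bset_subset_union (hq₁.trans hq₁₂) hq₁₂ q₃)
      _ ≤ _ := (measure_union_le _ _).trans
          (add_le_add_right ((measure_biUnion_finset_le _ _).trans hremoved) _)
  have hhfin : volume (Bset α ε q₀ q₂) / 2 ≠ ⊤ := ENNReal.div_ne_top hfin two_ne_zero
  nth_rewrite 1 [← ENNReal.add_halves (volume (Bset α ε q₀ q₂))] at hcover
  exact (ENNReal.add_le_add_iff_right hhfin).1 hcover
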